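/- arXiv:2310.03879 — 4 statements merged into one kernel-verified Lean document; each statement's English description precedes it below -/
import Mathlib

section
/- Let H be a complex Hilbert space, let p(X₁,…,X_m) = Σ_w a_w X_{w₁}⋯X_{w_{|w|}} be a noncommutative polynomial filter, let S₁,…,S_m and T₀, T₁ be bounded operators on H, set S̃_i = S_i + T₀ + T₁S_i, and suppose ‖S_i‖ ≤ B, ‖S̃_i‖ ≤ B for all i. If σ : H → H is Lipschitz with constant C, then for every x ∈ H, ‖σ(p(S₁,…,S_m)x) − σ(p(S̃₁,…,S̃_m)x)‖ ≤ C · (Σ_w |a_w|·|w|·B^{|w|−1}) · (‖T₀‖ + ‖T₁‖·B) · ‖x‖. -/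
theorem List.norm_prod_map_le_pow {ι R : Type*} [SeminormedRing R] (h1 : ‖(1 : R)‖ ≤ 1)
    {f : ι → R} {B : ℝ} (hf : ∀ i, ‖f i‖ ≤ B) (w : List ι) :
    ‖(w.map f).prod‖ ≤ B ^ w.length := by
  induction w with
  | nil => simpa using h1
  | cons i w ih =>
    have hB : 0 ≤ B := (norm_nonneg _).trans (hf i)
    rw [List.map_cons, List.prod_cons, List.length_cons, pow_succ']
    exact (norm_mul_le _ _).trans (mul_le_mul (hf i) ih (norm_nonneg _) hB)

/-- Telescoping bound for the difference of two noncommutative monomials. -/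
theorem List.norm_prod_map_sub_prod_map_le {ι R : Type*} [SeminormedRing R]
    (h1 : ‖(1 : R)‖ ≤ 1) {f g : ι → R} {B D : ℝ} (hf : ∀ i, ‖f i‖ ≤ B)
    (hg : ∀ i, ‖g i‖ ≤ B) (hfg : ∀ i, ‖f i - g i‖ ≤ D) (w : List ι) :
    ‖(w.map f).prod - (w.map g).prod‖ ≤ w.length * B ^ (w.length - 1) * D := by
  induction w with
  | nil => simp
  | cons i w ih =>
    have hB : 0 ≤ B := (norm_nonneg _).trans (hf i)
    have hD : 0 ≤ D := (norm_nonneg _).trans (hfg i)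
    have hpow : B * (w.length * B ^ (w.length - 1)) = w.length * B ^ w.length := by
      cases w with
      | nil => simp
      | cons j v =>
        simp only [List.length_cons, Nat.add_sub_cancel, pow_succ]
        ring
    simp only [List.map_cons, List.prod_cons, List.length_cons, Nat.add_sub_cancel]
    calc ‖f i * (w.map f).prod - g i * (w.map g).prod‖
        = ‖f i * ((w.map f).prod - (w.map g).prod) + (f i - g i) * (w.map g).prod‖ := by
          congr 1
          noncomm_ring
      _ ≤ ‖f i‖ * ‖(w.map f).prod - (w.map g).prod‖ + ‖f i - g i‖ * ‖(w.map g).prod‖ :=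
          (norm_add_le _ _).trans (add_le_add (norm_mul_le _ _) (norm_mul_le _ _))
      _ ≤ B * (w.length * B ^ (w.length - 1) * D) + D * B ^ w.length :=
          add_le_add (mul_le_mul (hf i) ih (norm_nonneg _) hB)
            (mul_le_mul (hfg i) (List.norm_prod_map_le_pow h1 hg w) (norm_nonneg _) hD)
      _ = ((w.length + 1 : ℕ) : ℝ) * B ^ w.length * D := by
          push_cast
          linear_combination D * hpow

/-- Single-layer stability (honest form of the paper's Theorem 2): with a
noncommutative polynomial filter `p = Σ_{w ∈ W} a_w X_w`, perturbed shifts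
`S̃ i = S i + T₀ + T₁ S i`, all operator norms bounded by `B`, and `σ` Lipschitz with
constant `C`: `‖σ(p(S)x) − σ(p(S̃)x)‖ ≤ C (Σ_w |a_w| |w| B^{|w|−1}) (‖T₀‖ + ‖T₁‖ B) ‖x‖`. -/
theorem layer_stability {H : Type*} [NormedAddCommGroup H] [InnerProductSpace ℂ H]
    [CompleteSpace H] {m : ℕ} (W : Finset (List (Fin m))) (a : List (Fin m) → ℂ)
    (S : Fin m → H →L[ℂ] H) (T0 T1 : H →L[ℂ] H) (B : ℝ)
    (hS : ∀ i, ‖S i‖ ≤ B)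
    (hS' : ∀ i, ‖S i + T0 + T1.comp (S i)‖ ≤ B)
    (C : NNReal) (σ : H → H) (hσ : LipschitzWith C σ) (x : H) :
    ‖σ ((∑ w ∈ W, a w • (w.map S).prod) x) -
        σ ((∑ w ∈ W, a w • (w.map (fun i => S i + T0 + T1.comp (S i))).prod) x)‖ ≤
      (C : ℝ) * (∑ w ∈ W, ‖a w‖ * w.length * B ^ (w.length - 1)) *
        (‖T0‖ + ‖T1‖ * B) * ‖x‖ := by
  have hdiff : ∀ i, ‖S i - (S i + T0 + T1.comp (S i))‖ ≤ ‖T0‖ + ‖T1‖ * B := fun i =>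
    calc ‖S i - (S i + T0 + T1.comp (S i))‖ = ‖T0 + T1.comp (S i)‖ := by
          rw [← norm_neg]
          congr 1
          abel
      _ ≤ ‖T0‖ + ‖T1‖ * ‖S i‖ :=
          (norm_add_le _ _).trans (add_le_add le_rfl (T1.opNorm_comp_le (S i)))
      _ ≤ ‖T0‖ + ‖T1‖ * B := by
          gcongr
          exact hS i
  have hfilter : ‖(∑ w ∈ W, a w • (w.map S).prod) -
      ∑ w ∈ W, a w • (w.map (fun i => S i + T0 + T1.comp (S i))).prod‖ ≤
      (∑ w ∈ W, ‖a w‖ * w.length * B ^ (w.length - 1)) * (‖T0‖ + ‖T1‖ * B) := by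
    rw [← Finset.sum_sub_distrib, Finset.sum_mul]
    refine norm_sum_le_of_le _ fun w _ => ?_
    rw [← smul_sub, norm_smul, mul_assoc ‖a w‖, mul_assoc ‖a w‖]
    exact mul_le_mul_of_nonneg_left (List.norm_prod_map_sub_prod_map_le
      ContinuousLinearMap.norm_id_le hS hS' hdiff w) (norm_nonneg _)
  refine (hσ.norm_sub_le _ _).trans ?_
  rw [← sub_apply, mul_assoc (C : ℝ), mul_assoc (C : ℝ)]
  exact mul_le_mul_of_nonneg_left (ContinuousLinearMap.le_of_opNorm_le _ hfilter x) C.2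
end

section
/- Let H₀, H₁, …, H_L be normed vector spaces. For each ℓ = 1,…,L let A_ℓ, Ã_ℓ : H_{ℓ−1} → H_ℓ be continuous linear maps with ‖A_ℓ‖ ≤ B_ℓ, ‖Ã_ℓ‖ ≤ B_ℓ and ‖A_ℓ − Ã_ℓ‖ ≤ Δ_ℓ, and let σ_ℓ : H_ℓ → H_ℓ be Lipschitz with constant C_ℓ and σ_ℓ(0) = 0. Define Φ(x) = σ_L(A_L σ_{L−1}(A_{L−1} ⋯ σ₁(A₁ x))) and Φ̃(x) = σ_L(Ã_L σ_{L−1}(Ã_{L−1} ⋯ σ₁(Ã₁ x))). Then for every x ∈ H₀, ‖Φ(x) − Φ̃(x)‖ ≤ Σ_{ℓ=1}^{L} Δ_ℓ · (∏_{r=ℓ}^{L} C_r) · (∏_{r=ℓ+1}^{L} B_r) · (∏_{r=1}^{ℓ−1} C_r B_r) · ‖x‖. -/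
theorem norm_layer_le {E F : Type*} [NormedAddCommGroup E] [NormedSpace ℂ E]
    [NormedAddCommGroup F] [NormedSpace ℂ F] {A : E →L[ℂ] F} {σ : F → F} {b : ℝ} {c : NNReal}
    (hA : ‖A‖ ≤ b) (hσ : LipschitzWith c σ) (hσ0 : σ 0 = 0) (x : E) :
    ‖σ (A x)‖ ≤ c * b * ‖x‖ := by
  calc ‖σ (A x)‖ ≤ c * ‖A x‖ := by simpa [hσ0] using hσ.norm_sub_le (A x) 0
    _ ≤ c * (b * ‖x‖) := by gcongr; exact A.le_of_opNorm_le hA x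
    _ = c * b * ‖x‖ := by ring

theorem norm_layer_sub_layer_le {E F : Type*} [NormedAddCommGroup E] [NormedSpace ℂ E]
    [NormedAddCommGroup F] [NormedSpace ℂ F] {A A' : E →L[ℂ] F} {σ : F → F} {b δ : ℝ}
    {c : NNReal} (hA' : ‖A'‖ ≤ b) (hδ : ‖A - A'‖ ≤ δ) (hσ : LipschitzWith c σ) (x x' : E) :
    ‖σ (A x) - σ (A' x')‖ ≤ c * (b * ‖x - x'‖ + δ * ‖x‖) := by
  have hsplit : A x - A' x' = A' (x - x') + (A - A') x := by simp
  calc ‖σ (A x) - σ (A' x')‖ ≤ c * ‖A x - A' x'‖ := hσ.norm_sub_le _ _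
    _ ≤ c * (‖A' (x - x')‖ + ‖(A - A') x‖) := by
      rw [hsplit]; gcongr; exact norm_add_le _ _
    _ ≤ c * (b * ‖x - x'‖ + δ * ‖x‖) := by
      gcongr
      · exact A'.le_of_opNorm_le hA' _
      · exact (A - A').le_of_opNorm_le hδ x

theorem norm_iterated_layers_le {H : ℕ → Type*} [∀ ℓ, NormedAddCommGroup (H ℓ)]
    [∀ ℓ, NormedSpace ℂ (H ℓ)] {A : ∀ ℓ, H ℓ →L[ℂ] H (ℓ + 1)}
    {σ : ∀ ℓ, H (ℓ + 1) → H (ℓ + 1)} {B : ℕ → ℝ} {C : ℕ → NNReal}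
    (hA : ∀ ℓ, ‖A ℓ‖ ≤ B ℓ) (hσ : ∀ ℓ, LipschitzWith (C ℓ) (σ ℓ)) (hσ0 : ∀ ℓ, σ ℓ 0 = 0)
    {x : ∀ ℓ, H ℓ} (hx : ∀ ℓ, x (ℓ + 1) = σ ℓ (A ℓ (x ℓ))) (n : ℕ) :
    ‖x n‖ ≤ (∏ r ∈ Finset.range n, (C r : ℝ) * B r) * ‖x 0‖ := by
  induction n with
  | zero => simp
  | succ n ih =>
    have hB : 0 ≤ B n := (norm_nonneg _).trans (hA n)
    calc ‖x (n + 1)‖ ≤ C n * B n * ‖x n‖ := by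
          rw [hx n]; exact norm_layer_le (hA n) (hσ n) (hσ0 n) (x n)
      _ ≤ C n * B n * ((∏ r ∈ Finset.range n, (C r : ℝ) * B r) * ‖x 0‖) := by gcongr
      _ = (∏ r ∈ Finset.range (n + 1), (C r : ℝ) * B r) * ‖x 0‖ := by
          rw [Finset.prod_range_succ]; ring

/-- End-to-end stability of an `L`-layer algebraic neural network (honest
form of the paper's Theorem 3): with unperturbed layers `x (ℓ+1) = σ ℓ (A ℓ (x ℓ))` and
perturbed layers `x' (ℓ+1) = σ ℓ (A' ℓ (x' ℓ))` started from the same input, where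
`‖A ℓ‖ ≤ B ℓ`, `‖A' ℓ‖ ≤ B ℓ`, `‖A ℓ − A' ℓ‖ ≤ Δ ℓ`, `σ ℓ` is `C ℓ`-Lipschitz with
`σ ℓ 0 = 0`, the outputs satisfy
`‖x L − x' L‖ ≤ Σ_{ℓ<L} Δ ℓ (∏_{ℓ≤r<L} C r)(∏_{ℓ<r<L} B r)(∏_{r<ℓ} C r B r) ‖x 0‖`.
(Layers are indexed from `0`.) -/
theorem algnn_stability {H : ℕ → Type*} [∀ ℓ, NormedAddCommGroup (H ℓ)]
    [∀ ℓ, NormedSpace ℂ (H ℓ)] (L : ℕ)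
    (A A' : ∀ ℓ, H ℓ →L[ℂ] H (ℓ + 1)) (σ : ∀ ℓ, H (ℓ + 1) → H (ℓ + 1))
    (B Δ : ℕ → ℝ) (C : ℕ → NNReal)
    (hA : ∀ ℓ, ‖A ℓ‖ ≤ B ℓ) (hA' : ∀ ℓ, ‖A' ℓ‖ ≤ B ℓ)
    (hΔ : ∀ ℓ, ‖A ℓ - A' ℓ‖ ≤ Δ ℓ)
    (hσ : ∀ ℓ, LipschitzWith (C ℓ) (σ ℓ)) (hσ0 : ∀ ℓ, σ ℓ 0 = 0)
    (x x' : ∀ ℓ, H ℓ) (h0 : x 0 = x' 0)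
    (hx : ∀ ℓ, x (ℓ + 1) = σ ℓ (A ℓ (x ℓ)))
    (hx' : ∀ ℓ, x' (ℓ + 1) = σ ℓ (A' ℓ (x' ℓ))) :
    ‖x L - x' L‖ ≤
      ∑ ℓ ∈ Finset.range L,
        Δ ℓ * (∏ r ∈ Finset.Ico ℓ L, (C r : ℝ)) * (∏ r ∈ Finset.Ico (ℓ + 1) L, B r) *
          (∏ r ∈ Finset.range ℓ, (C r : ℝ) * B r) * ‖x 0‖ := by
  induction L with
  | zero => simp [h0]
  | succ n ih =>
    have hB : 0 ≤ B n := (norm_nonneg _).trans (hA n)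
    have hD : 0 ≤ Δ n := (norm_nonneg _).trans (hΔ n)
    have hxn := norm_iterated_layers_le hA hσ hσ0 hx n
    have hstep : ‖x (n + 1) - x' (n + 1)‖ ≤ C n * (B n * ‖x n - x' n‖ + Δ n * ‖x n‖) := by
      rw [hx n, hx' n]
      exact norm_layer_sub_layer_le (hA' n) (hΔ n) (hσ n) (x n) (x' n)
    refine (hstep.trans (mul_le_mul_of_nonneg_left (add_le_add
      (mul_le_mul_of_nonneg_left ih hB) (mul_le_mul_of_nonneg_left hxn hD))
      (C n).coe_nonneg)).trans_eq ?_
    rw [Finset.sum_range_succ, mul_add, ← mul_assoc, Finset.mul_sum]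
    congr 1
    · refine Finset.sum_congr rfl fun ℓ hℓ => ?_
      have hlt : ℓ < n := Finset.mem_range.mp hℓ
      rw [Finset.prod_Ico_succ_top hlt.le, Finset.prod_Ico_succ_top (Nat.succ_le_of_lt hlt)]
      ring
    · simp only [Nat.Ico_succ_singleton, Finset.prod_singleton, Finset.Ico_self,
        Finset.prod_empty]
      ring
end

section
/- Let H be a complex Hilbert space. For each layer ℓ = 1,…,L let p_ℓ be a noncommutative polynomial filter in m operator variables, let S_{1,ℓ},…,S_{m,ℓ} and T₀^{(ℓ)}, T₁^{(ℓ)} be bounded operators on H, set S̃_{i,ℓ} = S_{i,ℓ} + T₀^{(ℓ)} + T₁^{(ℓ)} S_{i,ℓ}, and suppose ‖S_{i,ℓ}‖ ≤ B, ‖S̃_{i,ℓ}‖ ≤ B for all i, ℓ. Suppose also ‖p_ℓ(S_{1,ℓ},…,S_{m,ℓ})‖ ≤ B_ℓ and ‖p_ℓ(S̃_{1,ℓ},…,S̃_{m,ℓ})‖ ≤ B_ℓ, and let σ_ℓ : H → H be Lipschitz with constant C_ℓ and σ_ℓ(0) = 0. Let Φ(x) (resp. Φ̃(x)) be the output of the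 L-layer network that alternates the filters p_ℓ(S_{1,ℓ},…,S_{m,ℓ}) (resp. p_ℓ(S̃_{1,ℓ},…,S̃_{m,ℓ})) with the maps σ_ℓ. Then ‖Φ(x) − Φ̃(x)‖ ≤ Σ_{ℓ=1}^{L} K_ℓ · (‖T₀^{(ℓ)}‖ + ‖T₁^{(ℓ)}‖·B) · (∏_{r=ℓ}^{L} C_r) · (∏_{r=ℓ+1}^{L} B_r) · (∏_{r=1}^{ℓ−1} C_r B_r) · ‖x‖, where K_ℓ = Σ_w |a_w^{(ℓ)}|·|w|·B^{|w|−1} and a_w^{(ℓ)} are the coefficients of p_ℓ. -/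
section WordStability

variable {𝕜 E ι : Type*} [NontriviallyNormedField 𝕜] [NormedAddCommGroup E] [NormedSpace 𝕜 E]

theorem ContinuousLinearMap.norm_list_map_prod_le_pow {f : ι → E →L[𝕜] E} {B : ℝ}
    (hf : ∀ i, ‖f i‖ ≤ B) (w : List ι) : ‖(w.map f).prod‖ ≤ B ^ w.length := by
  induction w with
  | nil => exact ContinuousLinearMap.norm_id_le
  | cons i w ih =>
    have hB : 0 ≤ B := (norm_nonneg _).trans (hf i)
    rw [List.map_cons, List.prod_cons, List.length_cons, pow_succ']
    exact (norm_mul_le _ _).trans (by gcongr; exact hf i)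

theorem ContinuousLinearMap.norm_list_map_prod_sub_le {f g : ι → E →L[𝕜] E} {B D : ℝ}
    (hf : ∀ i, ‖f i‖ ≤ B) (hg : ∀ i, ‖g i‖ ≤ B) (hfg : ∀ i, ‖f i - g i‖ ≤ D) (w : List ι) :
    ‖(w.map f).prod - (w.map g).prod‖ ≤ w.length * B ^ (w.length - 1) * D := by
  induction w with
  | nil => simp
  | cons i w ih =>
    have hB : 0 ≤ B := (norm_nonneg _).trans (hf i)
    have hD : 0 ≤ D := (norm_nonneg _).trans (hfg i)
    have hpow : (w.length : ℝ) * B ^ w.length = w.length * (B * B ^ (w.length - 1)) := by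
      rcases Nat.eq_zero_or_pos w.length with h | h
      · simp [h]
      · rw [mul_pow_sub_one h.ne']
    simp only [List.map_cons, List.prod_cons, List.length_cons, Nat.add_sub_cancel]
    calc ‖f i * (w.map f).prod - g i * (w.map g).prod‖
        = ‖f i * ((w.map f).prod - (w.map g).prod) + (f i - g i) * (w.map g).prod‖ := by
          congr 1; noncomm_ring
      _ ≤ ‖f i‖ * ‖(w.map f).prod - (w.map g).prod‖ + ‖f i - g i‖ * ‖(w.map g).prod‖ :=
          (norm_add_le _ _).trans (add_le_add (norm_mul_le _ _) (norm_mul_le _ _))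
      _ ≤ B * (w.length * B ^ (w.length - 1) * D) + D * B ^ w.length := by
          gcongr
          · exact hf i
          · exact hfg i
          · exact norm_list_map_prod_le_pow hg w
      _ = ((w.length + 1 : ℕ) : ℝ) * B ^ w.length * D := by
          push_cast
          linear_combination -D * hpow

theorem ContinuousLinearMap.norm_sum_smul_list_map_prod_sub_le {f g : ι → E →L[𝕜] E} {B D : ℝ}
    (hf : ∀ i, ‖f i‖ ≤ B) (hg : ∀ i, ‖g i‖ ≤ B) (hfg : ∀ i, ‖f i - g i‖ ≤ D)
    (W : Finset (List ι)) (a : List ι → 𝕜) :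
    ‖∑ w ∈ W, a w • (w.map f).prod - ∑ w ∈ W, a w • (w.map g).prod‖ ≤
      (∑ w ∈ W, ‖a w‖ * w.length * B ^ (w.length - 1)) * D := by
  rw [← Finset.sum_sub_distrib, Finset.sum_mul]
  refine norm_sum_le_of_le _ fun w _ => ?_
  rw [← smul_sub, norm_smul, mul_assoc ‖a w‖, mul_assoc ‖a w‖]
  gcongr
  exact norm_list_map_prod_sub_le hf hg hfg w

end WordStability

section Cascade

variable {𝕜 E : Type*} [NontriviallyNormedField 𝕜] [NormedAddCommGroup E] [NormedSpace 𝕜 E]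
  {P P' : ℕ → E →L[𝕜] E} {b ε : ℕ → ℝ} {C : ℕ → NNReal} {σ : ℕ → E → E} {x x' : ℕ → E}

theorem norm_cascade_le (hP : ∀ ℓ, ‖P ℓ‖ ≤ b ℓ) (hσ : ∀ ℓ, LipschitzWith (C ℓ) (σ ℓ))
    (hσ0 : ∀ ℓ, σ ℓ 0 = 0) (hx : ∀ ℓ, x (ℓ + 1) = σ ℓ (P ℓ (x ℓ))) (L : ℕ) :
    ‖x L‖ ≤ (∏ r ∈ Finset.range L, (C r : ℝ) * b r) * ‖x 0‖ := by
  induction L with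
  | zero => simp
  | succ L ih =>
    have hb : 0 ≤ b L := (norm_nonneg _).trans (hP L)
    calc ‖x (L + 1)‖ ≤ C L * ‖P L (x L)‖ := by
          simpa [hx, hσ0] using (hσ L).norm_sub_le (P L (x L)) 0
      _ ≤ C L * (b L * ((∏ r ∈ Finset.range L, (C r : ℝ) * b r) * ‖x 0‖)) := by
          gcongr
          exact (P L).le_of_opNorm_le_of_le (hP L) ih
      _ = (∏ r ∈ Finset.range (L + 1), (C r : ℝ) * b r) * ‖x 0‖ := by
          rw [Finset.prod_range_succ]; ring

theorem norm_cascade_sub_le (hP : ∀ ℓ, ‖P ℓ‖ ≤ b ℓ) (hP' : ∀ ℓ, ‖P' ℓ‖ ≤ b ℓ)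
    (hPP' : ∀ ℓ, ‖P ℓ - P' ℓ‖ ≤ ε ℓ) (hσ : ∀ ℓ, LipschitzWith (C ℓ) (σ ℓ))
    (hσ0 : ∀ ℓ, σ ℓ 0 = 0) (h0 : x 0 = x' 0) (hx : ∀ ℓ, x (ℓ + 1) = σ ℓ (P ℓ (x ℓ)))
    (hx' : ∀ ℓ, x' (ℓ + 1) = σ ℓ (P' ℓ (x' ℓ))) (L : ℕ) :
    ‖x L - x' L‖ ≤ ∑ ℓ ∈ Finset.range L, ε ℓ * (∏ r ∈ Finset.Ico ℓ L, (C r : ℝ)) *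
      (∏ r ∈ Finset.Ico (ℓ + 1) L, b r) *
        (∏ r ∈ Finset.range ℓ, (C r : ℝ) * b r) * ‖x 0‖ := by
  induction L with
  | zero => simp [h0]
  | succ L ih =>
    have hb : 0 ≤ b L := (norm_nonneg _).trans (hP L)
    have hsplit : P L (x L) - P' L (x' L) = (P L - P' L) (x L) + P' L (x L - x' L) := by
      simp
    rw [Finset.sum_range_succ]
    calc ‖x (L + 1) - x' (L + 1)‖ ≤ C L * ‖P L (x L) - P' L (x' L)‖ := by
          rw [hx, hx']; exact (hσ L).norm_sub_le _ _
      _ ≤ C L * (ε L * ((∏ r ∈ Finset.range L, (C r : ℝ) * b r) * ‖x 0‖) +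
            b L * ‖x L - x' L‖) := by
          rw [hsplit]
          gcongr
          exact norm_add_le_of_le
            ((P L - P' L).le_of_opNorm_le_of_le (hPP' L) (norm_cascade_le hP hσ hσ0 hx L))
            ((P' L).le_of_opNorm_le (hP' L) _)
      _ = C L * b L * ‖x L - x' L‖ +
            ε L * C L * (∏ r ∈ Finset.range L, (C r : ℝ) * b r) * ‖x 0‖ := by ring
      _ ≤ _ := by
          refine add_le_add ((mul_le_mul_of_nonneg_left ih (by positivity)).trans_eq ?_) ?_
          · rw [Finset.mul_sum]
            refine Finset.sum_congr rfl fun ℓ hℓ => ?_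
            have hlt : ℓ < L := Finset.mem_range.1 hℓ
            rw [Finset.prod_Ico_succ_top hlt.le, Finset.prod_Ico_succ_top hlt]
            ring
          · simp

end Cascade


/-- Fully explicit end-to-end stability for polynomial filters under the
absolute-plus-relative perturbation model (paper's Theorem 3, honest form). For each layer
`ℓ` the filter is `p ℓ = Σ_{w ∈ W ℓ} a ℓ w • X_w`, the shift operators are `S ℓ i` with
perturbed versions `S ℓ i + T0 ℓ + T1 ℓ ∘ S ℓ i`, all bounded by `B`; the filters are
bounded by `Bl ℓ`, and `σ ℓ` is `C ℓ`-Lipschitz with `σ ℓ 0 = 0`. Then the network outputs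
after `L` layers satisfy
`‖x L − x' L‖ ≤ Σ_{ℓ<L} K ℓ (‖T0 ℓ‖ + ‖T1 ℓ‖ B) (∏_{ℓ≤r<L} C r)(∏_{ℓ<r<L} Bl r)
(∏_{r<ℓ} C r Bl r) ‖x 0‖` with `K ℓ = Σ_{w ∈ W ℓ} ‖a ℓ w‖ |w| B^{|w|−1}`.
(Layers are indexed from `0`.) -/
theorem algnn_polynomial_stability {H : Type*} [NormedAddCommGroup H]
    [InnerProductSpace ℂ H] [CompleteSpace H] {m : ℕ} (L : ℕ)
    (W : ℕ → Finset (List (Fin m))) (a : ℕ → List (Fin m) → ℂ)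
    (S : ℕ → Fin m → H →L[ℂ] H) (T0 T1 : ℕ → H →L[ℂ] H) (B : ℝ)
    (Bl : ℕ → ℝ) (C : ℕ → NNReal) (σ : ℕ → H → H)
    (hS : ∀ ℓ i, ‖S ℓ i‖ ≤ B)
    (hS' : ∀ ℓ i, ‖S ℓ i + T0 ℓ + (T1 ℓ).comp (S ℓ i)‖ ≤ B)
    (hP : ∀ ℓ, ‖∑ w ∈ W ℓ, a ℓ w • (w.map (S ℓ)).prod‖ ≤ Bl ℓ)
    (hP' : ∀ ℓ, ‖∑ w ∈ W ℓ,
        a ℓ w • (w.map (fun i => S ℓ i + T0 ℓ + (T1 ℓ).comp (S ℓ i))).prod‖ ≤ Bl ℓ)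
    (hσ : ∀ ℓ, LipschitzWith (C ℓ) (σ ℓ)) (hσ0 : ∀ ℓ, σ ℓ 0 = 0)
    (x x' : ℕ → H) (h0 : x 0 = x' 0)
    (hx : ∀ ℓ, x (ℓ + 1) = σ ℓ ((∑ w ∈ W ℓ, a ℓ w • (w.map (S ℓ)).prod) (x ℓ)))
    (hx' : ∀ ℓ, x' (ℓ + 1) = σ ℓ ((∑ w ∈ W ℓ,
        a ℓ w • (w.map (fun i => S ℓ i + T0 ℓ + (T1 ℓ).comp (S ℓ i))).prod) (x' ℓ))) :
    ‖x L - x' L‖ ≤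
      ∑ ℓ ∈ Finset.range L,
        (∑ w ∈ W ℓ, ‖a ℓ w‖ * w.length * B ^ (w.length - 1)) *
          (‖T0 ℓ‖ + ‖T1 ℓ‖ * B) * (∏ r ∈ Finset.Ico ℓ L, (C r : ℝ)) *
            (∏ r ∈ Finset.Ico (ℓ + 1) L, Bl r) *
              (∏ r ∈ Finset.range ℓ, (C r : ℝ) * Bl r) * ‖x 0‖ := by
  refine norm_cascade_sub_le hP hP' (fun ℓ => ?_) hσ hσ0 h0 hx hx' L
  refine ContinuousLinearMap.norm_sum_smul_list_map_prod_sub_le (hS ℓ) (hS' ℓ) (fun i => ?_) _ _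
  have hdiff : S ℓ i - (S ℓ i + T0 ℓ + (T1 ℓ).comp (S ℓ i)) =
      -(T0 ℓ + (T1 ℓ).comp (S ℓ i)) := by abel
  rw [hdiff, norm_neg]
  refine norm_add_le_of_le le_rfl (((T1 ℓ).opNorm_comp_le _).trans ?_)
  gcongr
  exact hS ℓ i
end

section
/- Let H₀, H₁, …, H_L be normed vector spaces, A_ℓ, Ã_ℓ : H_{ℓ−1} → H_ℓ continuous linear maps with ‖A_ℓ‖ ≤ B_ℓ, ‖Ã_ℓ‖ ≤ B_ℓ, ‖A_ℓ − Ã_ℓ‖ ≤ Δ_ℓ, and σ_ℓ : H_ℓ → H_ℓ Lipschitz with constant C_ℓ and σ_ℓ(0) = 0. Define x_0 = x̃_0 = x, x_ℓ = σ_ℓ(A_ℓ x_{ℓ−1}) and x̃_ℓ = σ_ℓ(Ã_ℓ x̃_{ℓ−1}). Then for every ℓ ≥ 1, ‖x_ℓ − x̃_ℓ‖ ≤ C_ℓ B_ℓ ‖x_{ℓ−1} − x̃_{ℓ−1}‖ + C_ℓ Δ_ℓ (∏_{r=1}^{ℓ−1} C_r B_r) ‖x‖. -/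
/-- A signal propagated through layers `σ ℓ ∘ A ℓ` with `‖A ℓ‖ ≤ B ℓ` and `σ ℓ` being
`C ℓ`-Lipschitz and fixing `0` grows at most by the factor `C ℓ * B ℓ` in each layer. -/
theorem norm_layer_le_prod_mul {𝕜 : Type*} [NontriviallyNormedField 𝕜] {H : ℕ → Type*}
    [∀ ℓ, NormedAddCommGroup (H ℓ)] [∀ ℓ, NormedSpace 𝕜 (H ℓ)]
    {A : ∀ ℓ, H ℓ →L[𝕜] H (ℓ + 1)} {σ : ∀ ℓ, H (ℓ + 1) → H (ℓ + 1)}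
    {B : ℕ → ℝ} {C : ℕ → NNReal} (hA : ∀ ℓ, ‖A ℓ‖ ≤ B ℓ)
    (hσ : ∀ ℓ, LipschitzWith (C ℓ) (σ ℓ)) (hσ0 : ∀ ℓ, σ ℓ 0 = 0)
    {x : ∀ ℓ, H ℓ} (hx : ∀ ℓ, x (ℓ + 1) = σ ℓ (A ℓ (x ℓ))) (ℓ : ℕ) :
    ‖x ℓ‖ ≤ (∏ r ∈ Finset.range ℓ, (C r : ℝ) * B r) * ‖x 0‖ := by
  induction ℓ with
  | zero => simp
  | succ ℓ ih =>
    have hB : 0 ≤ B ℓ := (norm_nonneg _).trans (hA ℓ)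
    calc ‖x (ℓ + 1)‖ = ‖σ ℓ (A ℓ (x ℓ)) - σ ℓ 0‖ := by rw [hx, hσ0, sub_zero]
      _ ≤ C ℓ * ‖A ℓ (x ℓ)‖ := by simpa using (hσ ℓ).norm_sub_le (A ℓ (x ℓ)) 0
      _ ≤ C ℓ * (B ℓ * ((∏ r ∈ Finset.range ℓ, (C r : ℝ) * B r) * ‖x 0‖)) := by
        gcongr
        exact (A ℓ).le_of_opNorm_le_of_le (hA ℓ) ih
      _ = (∏ r ∈ Finset.range (ℓ + 1), (C r : ℝ) * B r) * ‖x 0‖ := by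
        rw [Finset.prod_range_succ]
        ring

/-- Per-layer recursion for the deviation between an algebraic neural
network and its perturbed version: with `x (ℓ+1) = σ ℓ (A ℓ (x ℓ))`,
`x' (ℓ+1) = σ ℓ (A' ℓ (x' ℓ))`, `x 0 = x' 0`, `‖A ℓ‖ ≤ B ℓ`, `‖A' ℓ‖ ≤ B ℓ`,
`‖A ℓ − A' ℓ‖ ≤ Δ ℓ`, `σ ℓ` being `C ℓ`-Lipschitz with `σ ℓ 0 = 0`, one has for each `ℓ`
`‖x (ℓ+1) − x' (ℓ+1)‖ ≤ C ℓ B ℓ ‖x ℓ − x' ℓ‖ + C ℓ Δ ℓ (∏_{r<ℓ} C r B r) ‖x 0‖`.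
(Layers are indexed from `0`.) -/
theorem algnn_deviation_recursion {H : ℕ → Type*} [∀ ℓ, NormedAddCommGroup (H ℓ)]
    [∀ ℓ, NormedSpace ℂ (H ℓ)]
    (A A' : ∀ ℓ, H ℓ →L[ℂ] H (ℓ + 1)) (σ : ∀ ℓ, H (ℓ + 1) → H (ℓ + 1))
    (B Δ : ℕ → ℝ) (C : ℕ → NNReal)
    (hA : ∀ ℓ, ‖A ℓ‖ ≤ B ℓ) (hA' : ∀ ℓ, ‖A' ℓ‖ ≤ B ℓ)
    (hΔ : ∀ ℓ, ‖A ℓ - A' ℓ‖ ≤ Δ ℓ)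
    (hσ : ∀ ℓ, LipschitzWith (C ℓ) (σ ℓ)) (hσ0 : ∀ ℓ, σ ℓ 0 = 0)
    (x x' : ∀ ℓ, H ℓ) (h0 : x 0 = x' 0)
    (hx : ∀ ℓ, x (ℓ + 1) = σ ℓ (A ℓ (x ℓ)))
    (hx' : ∀ ℓ, x' (ℓ + 1) = σ ℓ (A' ℓ (x' ℓ))) :
    ∀ ℓ, ‖x (ℓ + 1) - x' (ℓ + 1)‖ ≤
      (C ℓ : ℝ) * B ℓ * ‖x ℓ - x' ℓ‖ +
        (C ℓ : ℝ) * Δ ℓ * (∏ r ∈ Finset.range ℓ, (C r : ℝ) * B r) * ‖x 0‖ := by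
  intro ℓ
  have hx'_le : ‖x' ℓ‖ ≤ (∏ r ∈ Finset.range ℓ, (C r : ℝ) * B r) * ‖x 0‖ :=
    h0 ▸ norm_layer_le_prod_mul hA' hσ hσ0 hx' ℓ
  have hsplit : A ℓ (x ℓ) - A' ℓ (x' ℓ) = A ℓ (x ℓ - x' ℓ) + (A ℓ - A' ℓ) (x' ℓ) := by
    simp
  calc ‖x (ℓ + 1) - x' (ℓ + 1)‖
      ≤ C ℓ * ‖A ℓ (x ℓ) - A' ℓ (x' ℓ)‖ := by
        rw [hx, hx']
        exact (hσ ℓ).norm_sub_le _ _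
    _ ≤ C ℓ * (B ℓ * ‖x ℓ - x' ℓ‖ +
          Δ ℓ * ((∏ r ∈ Finset.range ℓ, (C r : ℝ) * B r) * ‖x 0‖)) := by
        rw [hsplit]
        gcongr
        exact norm_add_le_of_le ((A ℓ).le_of_opNorm_le (hA ℓ) _)
          ((A ℓ - A' ℓ).le_of_opNorm_le_of_le (hΔ ℓ) hx'_le)
    _ = _ := by ring
end
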